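/- arXiv:2412.08001 — 2 statements merged into one kernel-verified Lean document; each statement's English description precedes it below -/
import Mathlib

section
/- Let (A, ≺, ≻, ·) be a tridendriform algebra of weight λ over a field k, i.e. an extended tridendriform algebra of weight (λ,0). Define [x,y] := x·y − y·x and x ∘ y := x≻y − y≺x. Then (A, [,], ∘) is a post-Lie algebra of weight λ, i.e. an extended post-Lie algebra of weight (λ,0). -/
/-- A binary operation `f : A → A → A` is `k`-bilinear. -/
def IsBilinear (k : Type*) [Field k] {A : Type*} [AddCommGroup A] [Module k A]
    (f : A → A → A) : Prop :=
  (∀ (a : k) (x y z : A), f (a • x + y) z = a • f x z + f y z) ∧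
  (∀ (a : k) (x y z : A), f x (a • y + z) = a • f x y + f x z)

/-- `(A, ≺, ≻, ·)` is an extended tridendriform algebra of weight `(lam, kap)`:
the three operations are bilinear and satisfy the seven relations, where
`x ⋆ y = x ≺ y + x ≻ y + lam • (x · y)`. -/
def IsExtTridend (k : Type*) [Field k] {A : Type*} [AddCommGroup A] [Module k A]
    (lam kap : k) (prec succ dot : A → A → A) : Prop :=
  IsBilinear k prec ∧ IsBilinear k succ ∧ IsBilinear k dot ∧
  (∀ x y z : A,
    prec (prec x y) z
      = prec x (prec y z + succ y z + lam • dot y z) + kap • dot x (dot y z)) ∧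
  (∀ x y z : A, prec (succ x y) z = succ x (prec y z)) ∧
  (∀ x y z : A,
    succ (prec x y + succ x y + lam • dot x y) z + kap • dot (dot x y) z
      = succ x (succ y z)) ∧
  (∀ x y z : A, dot (succ x y) z = succ x (dot y z)) ∧
  (∀ x y z : A, dot (prec x y) z = dot x (succ y z)) ∧
  (∀ x y z : A, prec (dot x y) z = dot x (prec y z)) ∧
  (∀ x y z : A, dot (dot x y) z = dot x (dot y z))

/-- `(A, br, circ)` is an extended post-Lie algebra of weight `(lam, kap)`:
`br` is a Lie bracket (bilinear, alternating, Jacobi) and the bilinear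
operation `circ` satisfies the two compatibility conditions. -/
def IsExtPostLie (k : Type*) [Field k] {A : Type*} [AddCommGroup A] [Module k A]
    (lam kap : k) (br circ : A → A → A) : Prop :=
  IsBilinear k br ∧ IsBilinear k circ ∧
  (∀ x : A, br x x = 0) ∧
  (∀ x y z : A, br (br x y) z + br (br y z) x + br (br z x) y = 0) ∧
  (∀ x y z : A,
    circ (circ x y) z - circ (circ y x) z + lam • circ (br x y) z + kap • br (br x y) z
      = circ x (circ y z) - circ y (circ x z)) ∧
  (∀ x y z : A, circ x (br y z) = br (circ x y) z + br y (circ x z))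

namespace IsBilinear

variable {k A : Type*} [Field k] [AddCommGroup A] [Module k A] {f : A → A → A}

theorem add_left (hf : IsBilinear k f) (x y z : A) : f (x + y) z = f x z + f y z := by
  simpa using hf.1 1 x y z

theorem add_right (hf : IsBilinear k f) (x y z : A) : f x (y + z) = f x y + f x z := by
  simpa using hf.2 1 x y z

theorem zero_left (hf : IsBilinear k f) (z : A) : f 0 z = 0 := by
  simpa using hf.add_left 0 0 z

theorem zero_right (hf : IsBilinear k f) (x : A) : f x 0 = 0 := by
  simpa using hf.add_right x 0 0

theorem smul_left (hf : IsBilinear k f) (a : k) (x z : A) : f (a • x) z = a • f x z := by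
  simpa [hf.zero_left] using hf.1 a x 0 z

theorem smul_right (hf : IsBilinear k f) (a : k) (x y : A) : f x (a • y) = a • f x y := by
  simpa [hf.zero_right] using hf.2 a x y 0

theorem sub_left (hf : IsBilinear k f) (x y z : A) : f (x - y) z = f x z - f y z := by
  rw [eq_sub_iff_add_eq, ← hf.add_left, sub_add_cancel]

theorem sub_right (hf : IsBilinear k f) (x y z : A) : f x (y - z) = f x y - f x z := by
  rw [eq_sub_iff_add_eq, ← hf.add_right, sub_add_cancel]

theorem flip (hf : IsBilinear k f) : IsBilinear k fun x y => f y x :=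
  ⟨fun a x y z => hf.2 a z x y, fun a x y z => hf.1 a y z x⟩

theorem sub {g : A → A → A} (hf : IsBilinear k f) (hg : IsBilinear k g) :
    IsBilinear k fun x y => f x y - g x y := by
  constructor <;> intro a x y z
  · simp only [hf.1, hg.1]
    module
  · simp only [hf.2, hg.2]
    module

end IsBilinear

/-- A tridendriform algebra of weight `lam` (an extended tridendriform algebra of
weight `(lam, 0)`) induces a post-Lie algebra of weight `lam` (an extended
post-Lie algebra of weight `(lam, 0)`) via `[x, y] := x · y - y · x` and
`x ∘ y := x ≻ y - y ≺ x`. -/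
theorem tridend_toPostLie {k A : Type*} [Field k] [AddCommGroup A] [Module k A]
    (lam : k) (prec succ dot : A → A → A)
    (h : IsExtTridend k lam 0 prec succ dot) :
    IsExtPostLie k lam 0 (fun x y => dot x y - dot y x)
      (fun x y => succ x y - prec y x) := by
  obtain ⟨hp, hs, hd, h1, h2, h3, h4, h5, h6, h7⟩ := h
  refine ⟨hd.sub hd.flip, hs.sub hp.flip, fun x => sub_self _, fun x y z => ?_,
    fun x y z => ?_, fun x y z => ?_⟩
  · simp only [hd.sub_left, hd.sub_right, h7]
    abel
  · simp only [zero_smul, add_zero, hp.add_right, hp.smul_right] at h1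
    simp only [zero_smul, add_zero, hs.add_left, hs.smul_left] at h3
    simp only [hs.sub_left, hs.sub_right, hp.sub_left, hp.sub_right, h1, h2, ← h3]
    module
  · simp only [hs.sub_right, hp.sub_left, hd.sub_left, hd.sub_right, h4, h5, h6]
    abel
end

section
/- Let (A, ≺, ≻) be an extended dendriform algebra over a field k. Define x ⊲ y := x≺y, x ⊳ y := x≻y, and x ∘ y := x≻y − y≺x. Then (A, ⊲, ⊳, ∘) is an extended pre-Lie algebra. -/
/-- `(A, ≺, ≻)` is an extended dendriform algebra: the two operations are bilinear
and satisfy the two relations, where `x ⋆ y = x ≺ y + x ≻ y`. -/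
def IsExtDend (k : Type*) [Field k] {A : Type*} [AddCommGroup A] [Module k A]
    (prec succ : A → A → A) : Prop :=
  IsBilinear k prec ∧ IsBilinear k succ ∧
  (∀ x y z : A,
    prec (prec x y) z + succ (prec x y + succ x y) z
      = prec x (prec y z + succ y z) + succ x (succ y z)) ∧
  (∀ x y z : A, prec (succ x y) z = succ x (prec y z))

/-- `(A, tl, tr, circ)` is an extended pre-Lie algebra: the three operations are
bilinear and satisfy the two relations, where `x ∗ y := tl x y + tr x y`
(`tl` is `⊲` and `tr` is `⊳`). -/
def IsExtPreLie (k : Type*) [Field k] {A : Type*} [AddCommGroup A] [Module k A]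
    (tl tr circ : A → A → A) : Prop :=
  IsBilinear k tl ∧ IsBilinear k tr ∧ IsBilinear k circ ∧
  (∀ x y z : A,
    tl (tl x y) z - tl x (tl y z + tr y z) + tr (tl x y + tr x y) z - tr x (tr y z)
      = tl (tl y x) z - tl y (tl x z + tr x z) + tr (tl y x + tr y x) z - tr y (tr x z)) ∧
  (∀ x y z : A,
    circ (circ x y) z - circ x (circ y z) + tl (tl x y) z - tl x (tl y z + tr y z)
        + tr z (tr y x) - tr (tl z y + tr z y) x
      = circ (circ y x) z - circ y (circ x z) + tl (tl y x) z - tl y (tl x z + tr x z)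
        + tr z (tr x y) - tr (tl z x + tr z x) y)

section IsBilinear

variable {k A : Type*} [Field k] [AddCommGroup A] [Module k A] {f g : A → A → A}

theorem IsBilinear.add_left_s16 (hf : IsBilinear k f) (x y z : A) :
    f (x + y) z = f x z + f y z := by
  simpa using hf.1 1 x y z

theorem IsBilinear.add_right_s16 (hf : IsBilinear k f) (x y z : A) :
    f x (y + z) = f x y + f x z := by
  simpa using hf.2 1 x y z

theorem IsBilinear.sub_left_s16 (hf : IsBilinear k f) (x y z : A) :
    f (x - y) z = f x z - f y z := by
  rw [eq_sub_iff_add_eq, ← hf.add_left_s16, sub_add_cancel]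

theorem IsBilinear.sub_right_s16 (hf : IsBilinear k f) (x y z : A) :
    f x (y - z) = f x y - f x z := by
  rw [eq_sub_iff_add_eq, ← hf.add_right_s16, sub_add_cancel]

theorem IsBilinear.flip_s16 (hf : IsBilinear k f) : IsBilinear k (fun x y => f y x) :=
  ⟨fun a x y z => hf.2 a z x y, fun a x y z => hf.1 a y z x⟩

theorem IsBilinear.sub_s16 (hf : IsBilinear k f) (hg : IsBilinear k g) :
    IsBilinear k (fun x y => f x y - g x y) := by
  constructor <;> intro a x y z
  · simp only [hf.1, hg.1]
    module
  · simp only [hf.2, hg.2]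
    module

end IsBilinear

/-- An extended dendriform algebra `(A, ≺, ≻)` induces an extended pre-Lie algebra
via `x ⊲ y := x ≺ y`, `x ⊳ y := x ≻ y` and `x ∘ y := x ≻ y - y ≺ x`. -/
theorem extDend_toExtPreLie {k A : Type*} [Field k] [AddCommGroup A] [Module k A]
    (prec succ : A → A → A) (h : IsExtDend k prec succ) :
    IsExtPreLie k prec succ (fun x y => succ x y - prec y x) := by
  obtain ⟨hp, hs, h₁, h₂⟩ := h
  refine ⟨hp, hs, hs.sub_s16 hp.flip_s16, fun x y z => ?_, fun x y z => ?_⟩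
  · linear_combination (norm := abel) h₁ x y z - h₁ y x z
  · have hxyz := h₁ x y z
    have hyxz := h₁ y x z
    have hzyx := h₁ z y x
    have hzxy := h₁ z x y
    simp only [hp.add_right_s16, hs.add_left_s16, hp.sub_left_s16, hp.sub_right_s16, hs.sub_left_s16,
      hs.sub_right_s16] at hxyz hyxz hzyx hzxy ⊢
    linear_combination (norm := abel)
      hxyz - hyxz - hzyx + hzxy + h₂ y z x - h₂ x z y
end
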